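/- Let S be a contiguous stepping sequence for m. Then S or its reverse has the property that its first element is congruent to m − 1 modulo 2 and its last element is congruent to 1 modulo 2. -/

import Mathlib

open List

/-- The initial configuration `(1, 2, …, m)`. -/
def initConfig (m : ℕ) : List ℕ := (List.range m).map (· + 1)

/-- A move at index `i` (with `1 ≤ i ≤ m-1`) transposes the entries `q_i` and `q_{i+1}`
(one-indexed), i.e. the entries at zero-indexed positions `i-1` and `i`. -/
def swapAdj (q : List ℕ) (i : ℕ) : List ℕ :=
  (q.set (i - 1) (q.getD i 0)).set i (q.getD (i - 1) 0)

/-- The prefix set `S_k(q) = {q_1, …, q_k}`. -/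
def prefixSet (q : List ℕ) (k : ℕ) : Finset ℕ := (q.take k).toFinset

/-- The initial prefix sets `S_0 ⊂ S_1 ⊂ … ⊂ S_m` of the configuration `(1,…,m)`. -/
def initSets (m : ℕ) : List (Finset ℕ) :=
  (List.range (m + 1)).map (fun k => prefixSet (initConfig m) k)

/-- The sets generated by applying a sequence of moves starting from configuration `q`:
the `t`-th generated set is the prefix set of length `i_t` of the configuration
obtained after the `t`-th move. -/
def genSetsAux (q : List ℕ) : List ℕ → List (Finset ℕ)
  | [] => []
  | i :: rest => prefixSet (swapAdj q i) i :: genSetsAux (swapAdj q i) rest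

/-- The sets generated by the moves, starting from the initial configuration `(1,…,m)`. -/
def genSets (m : ℕ) (moves : List ℕ) : List (Finset ℕ) :=
  genSetsAux (initConfig m) moves

/-- `moves` is a stepping sequence for `m`: each move index lies in `{1,…,m-1}`, and the
initial prefix sets `S_0,…,S_m` together with the generated sets list every subset of
`{1,…,m}` exactly once. -/
def IsSteppingSeq (m : ℕ) (moves : List ℕ) : Prop :=
  (∀ i ∈ moves, 1 ≤ i ∧ i ≤ m - 1) ∧
  (initSets m ++ genSets m moves).Perm (Finset.Icc 1 m).powerset.toList

/-- A list of moves is contiguous if consecutive entries differ by exactly 1. -/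
def ContiguousList (G : List ℕ) : Prop :=
  ∀ t, t + 1 < G.length → ((G.getD t 0 : ℤ) - (G.getD (t + 1) 0 : ℤ)).natAbs = 1

/-- A stepping sequence for `m` is strongly contiguous if it is contiguous, begins
with `m-1`, and ends with `1`. -/
def StronglyContiguous (m : ℕ) (G : List ℕ) : Prop :=
  ContiguousList G ∧ G.head? = some (m - 1) ∧ G.getLast? = some 1

/-- A valid adjacent move permutes the entries of a configuration. -/
theorem swapAdj_perm {q : List ℕ} {i : ℕ} (h1 : 1 ≤ i) (hi : i < q.length) :
    (swapAdj q i).Perm q := by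
  have h : i - 1 < q.length := by omega
  rw [swapAdj, List.getD_eq_getElem _ _ hi, List.getD_eq_getElem _ _ h]
  exact List.set_set_perm h hi

/-- The prefix set of length `k` of a duplicate-free configuration has `k` elements. -/
theorem card_prefixSet {q : List ℕ} (hq : q.Nodup) {k : ℕ} (hk : k ≤ q.length) :
    (prefixSet q k).card = k := by
  rw [prefixSet, List.toFinset_card_of_nodup (hq.sublist (List.take_sublist k q)),
    List.length_take, min_eq_left hk]

/-- The cardinalities of the generated sets are the move indices. -/
theorem map_card_genSetsAux (moves : List ℕ) {q : List ℕ} (hq : q.Nodup)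
    (h : ∀ i ∈ moves, 1 ≤ i ∧ i < q.length) :
    (genSetsAux q moves).map Finset.card = moves := by
  induction moves generalizing q with
  | nil => rfl
  | cons i rest ih =>
    obtain ⟨h1, hi⟩ := h i (by simp)
    have hp := swapAdj_perm h1 hi
    have hn := hp.nodup_iff.mpr hq
    rw [genSetsAux, List.map_cons, card_prefixSet hn (hp.length_eq ▸ hi.le),
      ih hn fun j hj => hp.length_eq ▸ h j (List.mem_cons_of_mem _ hj)]

theorem length_initConfig (m : ℕ) : (initConfig m).length = m := by
  simp [initConfig]

theorem nodup_initConfig (m : ℕ) : (initConfig m).Nodup :=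
  List.nodup_range.map (add_left_injective 1)

/-- The cardinalities of the initial prefix sets are `0, …, m`. -/
theorem map_card_initSets (m : ℕ) :
    (initSets m).map Finset.card = List.range (m + 1) := by
  rw [initSets, List.map_map]
  conv_rhs => rw [← List.map_id (List.range (m + 1))]
  refine List.map_congr_left fun k hk => card_prefixSet (nodup_initConfig m) ?_
  rw [length_initConfig]
  exact Nat.lt_succ_iff.mp (List.mem_range.mp hk)

/-- The cardinalities occurring in the list of all subsets, for a stepping sequence. -/
theorem IsSteppingSeq.range_append_perm {m : ℕ} {S : List ℕ} (hm : 1 ≤ m)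
    (hS : IsSteppingSeq m S) :
    (List.range (m + 1) ++ S).Perm
      ((Finset.Icc 1 m).powerset.toList.map Finset.card) := by
  have h := hS.2.map Finset.card
  rwa [List.map_append, map_card_initSets, genSets,
    map_card_genSetsAux S (nodup_initConfig m) fun i hi => ?_] at h
  rw [length_initConfig]
  have := hS.1 i hi
  omega

/-- The alternating sign sum over a stepping sequence cancels that over `0, …, m`. -/
theorem IsSteppingSeq.sum_neg_one_pow {m : ℕ} {S : List ℕ} (hm : 1 ≤ m)
    (hS : IsSteppingSeq m S) :
    (∑ k ∈ Finset.range (m + 1), (-1 : ℤ) ^ k) + (S.map fun i => (-1 : ℤ) ^ i).sum = 0 := by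
  have h := ((hS.range_append_perm hm).map fun i => (-1 : ℤ) ^ i).sum_eq
  rw [List.map_append, List.sum_append, List.map_map] at h
  have hz : (((Finset.Icc 1 m).powerset.toList.map
      ((fun i => (-1 : ℤ) ^ i) ∘ Finset.card)).sum) = 0 :=
    (Finset.sum_map_toList _ _).trans
      (Finset.sum_powerset_neg_one_pow_card_of_nonempty ⟨1, by simp [hm]⟩)
  rw [hz] at h
  exact h

/-- A stepping sequence for `m ≥ 2` is nonempty. -/
theorem IsSteppingSeq.ne_nil {m : ℕ} {S : List ℕ} (hm : 2 ≤ m) (hS : IsSteppingSeq m S) :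
    S ≠ [] := by
  rintro rfl
  have h := (hS.range_append_perm (by omega)).length_eq
  simp at h
  have : m + 1 < 2 ^ m := by
    clear h hS
    induction m, hm using Nat.le_induction with
    | base => norm_num
    | succ n hn ih => rw [pow_succ]; omega
  omega

/-- Along a contiguous list the signs `(-1) ^ i` alternate, so their sum depends only on
the two ends. -/
theorem ContiguousList.two_mul_sum_neg_one_pow {a : ℕ} {l : List ℕ}
    (h : ContiguousList (a :: l)) :
    2 * ((a :: l).map fun i => (-1 : ℤ) ^ i).sum =
      (-1) ^ a + (-1) ^ ((a :: l).getLast (List.cons_ne_nil a l)) := by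
  induction l generalizing a with
  | nil => simp [two_mul]
  | cons b l ih =>
    have hb : ContiguousList (b :: l) := fun t ht => by simpa using h (t + 1) (by simpa using ht)
    have hab : ((a : ℤ) - b).natAbs = 1 := by simpa using h 0 (by simp)
    have hs : (-1 : ℤ) ^ a = -(-1) ^ b := by
      have : a = b + 1 ∨ b = a + 1 := by omega
      rcases this with rfl | rfl <;> simp [pow_succ]
    rw [List.map_cons, List.sum_cons, mul_add, ih hb, List.getLast_cons (List.cons_ne_nil b l),
      hs]
    ring

/-- Lemma 6.4: if `S` is a contiguous stepping sequence for `m`, then `S` or its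
reverse has first element congruent to `m - 1 (mod 2)` and last element congruent to
`1 (mod 2)`. -/
theorem contiguous_or_reverse_parity (m : ℕ) (hm : 2 ≤ m) (S : List ℕ)
    (hS : IsSteppingSeq m S) (hc : ContiguousList S) :
    (∃ a b, S.head? = some a ∧ S.getLast? = some b ∧
      a % 2 = (m - 1) % 2 ∧ b % 2 = 1 % 2) ∨
    (∃ a b, S.reverse.head? = some a ∧ S.reverse.getLast? = some b ∧
      a % 2 = (m - 1) % 2 ∧ b % 2 = 1 % 2) := by
  obtain ⟨a, l, rfl⟩ := List.exists_cons_of_ne_nil (hS.ne_nil hm)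
  have hsum := hS.sum_neg_one_pow (by omega)
  have htwo := hc.two_mul_sum_neg_one_pow
  have hlast := List.getLast?_eq_some_getLast (List.cons_ne_nil a l)
  generalize (a :: l).getLast (List.cons_ne_nil a l) = b at htwo hlast
  rw [neg_one_geom_sum] at hsum
  rw [List.head?_reverse, List.getLast?_reverse, hlast, List.head?_cons]
  suffices (a % 2 = (m - 1) % 2 ∧ b % 2 = 1 % 2) ∨ (b % 2 = (m - 1) % 2 ∧ a % 2 = 1 % 2) from
    this.imp (fun h => ⟨a, b, rfl, rfl, h⟩) (fun h => ⟨b, a, rfl, rfl, h⟩)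
  rcases Nat.even_or_odd a with ha | ha <;> rcases Nat.even_or_odd b with hb | hb <;>
    rcases Nat.even_or_odd m with hm' | hm' <;>
    simp only [ha.neg_one_pow, hb.neg_one_pow, Nat.even_add_one, hm', Nat.not_even_iff_odd.mpr,
      not_true_eq_false, not_false_eq_true, if_true, if_false] at hsum htwo <;>
    grind
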